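/- If P is a σ-linked partial order which contains at least ℵ₁-many distinct conditions and has no centered subset of size ℵ₁, then P is stationarily Knaster but does not have stationary precaliber ω₁. -/

import Mathlib

noncomputable section

open Set

/-- The first uncountable ordinal. -/
def omega1 : Ordinal.{0} := (Cardinal.aleph 1).ord

/-- `C` is a closed unbounded subset of `ω₁`. -/
def IsClubOmega1 (C : Set Ordinal) : Prop :=
  C ⊆ Set.Iio omega1 ∧
  (∀ α < omega1, ∃ β ∈ C, α < β) ∧
  (∀ α < omega1, α ≠ 0 → (∀ β < α, ∃ γ ∈ C, β < γ ∧ γ < α) → α ∈ C)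

/-- `S` is a stationary subset of `ω₁`. -/
def IsStationaryOmega1 (S : Set Ordinal) : Prop :=
  S ⊆ Set.Iio omega1 ∧ ∀ C, IsClubOmega1 C → (S ∩ C).Nonempty

/-- Two conditions are compatible if they have a common lower bound. -/
def Compat {P : Type*} [PartialOrder P] (p q : P) : Prop := ∃ r, r ≤ p ∧ r ≤ q

/-- A set of conditions is linked if its elements are pairwise compatible. -/
def Linked {P : Type*} [PartialOrder P] (B : Set P) : Prop :=
  ∀ p ∈ B, ∀ q ∈ B, Compat p q

/-- A set of conditions is centered if each of its finite subsets has a lower bound. -/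
def Centered {P : Type*} [PartialOrder P] (B : Set P) : Prop :=
  ∀ F : Finset P, ↑F ⊆ B → ∃ r : P, ∀ p ∈ F, r ≤ p

/-- `P` is stationarily Knaster. -/
def StationarilyKnaster (P : Type*) [PartialOrder P] : Prop :=
  ∀ S : Set Ordinal, IsStationaryOmega1 S → ∀ p : Ordinal → P,
    ∃ T ⊆ S, IsStationaryOmega1 T ∧ ∀ i ∈ T, ∀ j ∈ T, Compat (p i) (p j)

/-- `P` has stationary precaliber `ω₁`. -/
def StationaryPrecaliber (P : Type*) [PartialOrder P] : Prop :=
  ∀ S : Set Ordinal, IsStationaryOmega1 S → ∀ p : Ordinal → P,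
    ∃ T ⊆ S, IsStationaryOmega1 T ∧ Centered (p '' T)

/-- `P` is Knaster: every family of ℵ₁-many conditions has an uncountable
linked subfamily. -/
def Knaster (P : Type*) [PartialOrder P] : Prop :=
  ∀ p : Ordinal → P, ∃ X ⊆ Set.Iio omega1, ¬ X.Countable ∧
    ∀ i ∈ X, ∀ j ∈ X, Compat (p i) (p j)

theorem omega1_eq : omega1 = Ordinal.omega 1 := Cardinal.ord_aleph 1

theorem iSup_lt_omega1 {ι : Type*} [Countable ι] {f : ι → Ordinal} (hf : ∀ i, f i < omega1) :
    ⨆ i, f i < omega1 := by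
  rw [omega1_eq] at *
  exact Ordinal.iSup_lt_omega_one hf

theorem succ_lt_omega1 {α : Ordinal} (hα : α < omega1) : Order.succ α < omega1 := by
  rw [omega1_eq] at *
  exact (Cardinal.isSuccLimit_omega 1).succ_lt hα

theorem omega1_pos : 0 < omega1 := by
  rw [omega1_eq]
  exact Ordinal.omega_pos 1

/-- The intersection of countably many clubs is a club. -/
theorem IsClubOmega1.iInter {ι : Type} [Countable ι] [Nonempty ι] {C : ι → Set Ordinal}
    (hC : ∀ i, IsClubOmega1 (C i)) : IsClubOmega1 (⋂ i, C i) := by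
  refine ⟨fun x hx => (hC (Classical.arbitrary ι)).1 (mem_iInter.1 hx _), ?_, ?_⟩
  · intro α hα
    choose next next_mem lt_next using fun i => (hC i).2.1
    let step : Iio omega1 → Iio omega1 := fun β =>
      ⟨⨆ i, next i β β.2, iSup_lt_omega1 fun i => (hC i).1 (next_mem i β β.2)⟩
    have next_le (β : Iio omega1) (i : ι) : next i β β.2 ≤ step β :=
      Ordinal.le_iSup (fun i => next i β β.2) i
    have lt_step (β : Iio omega1) : (β : Ordinal) < step β :=
      (lt_next (Classical.arbitrary ι) β β.2).trans_le (next_le β _)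
    let a : ℕ → Iio omega1 := fun k => step^[k] ⟨α, hα⟩
    have a_succ (k : ℕ) : a (k + 1) = step (a k) := Function.iterate_succ_apply' step k _
    have a_lt (k : ℕ) : (a k : Ordinal) < ⨆ k, (a k : Ordinal) :=
      (a_succ k ▸ lt_step (a k)).trans_le (Ordinal.le_iSup (fun k => (a k : Ordinal)) (k + 1))
    refine ⟨⨆ k, (a k : Ordinal), mem_iInter.2 fun i => ?_, a_lt 0⟩
    refine (hC i).2.2 _ (iSup_lt_omega1 fun k => (a k).2)
      (bot_le.trans_lt (a_lt 0)).ne' fun β hβ => ?_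
    obtain ⟨k, hk⟩ := Ordinal.lt_iSup_iff.1 hβ
    exact ⟨next i (a k) (a k).2, next_mem i _ _, hk.trans (lt_next i _ _),
      (a_succ k ▸ next_le (a k) i).trans_lt (a_lt (k + 1))⟩
  · intro α hα h0 h
    refine mem_iInter.2 fun i => (hC i).2.2 α hα h0 fun β hβ => ?_
    obtain ⟨γ, hγ, h⟩ := h β hβ
    exact ⟨γ, mem_iInter.1 hγ i, h⟩

theorem isClubOmega1_Ioo {α : Ordinal} (hα : α < omega1) : IsClubOmega1 (Ioo α omega1) := by
  refine ⟨fun x hx => hx.2, fun β hβ => ?_, fun β hβ h0 h => ?_⟩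
  · exact ⟨Order.succ (max α β), ⟨Order.lt_succ_of_le (le_max_left _ _),
      succ_lt_omega1 (max_lt hα hβ)⟩, Order.lt_succ_of_le (le_max_right _ _)⟩
  · obtain ⟨γ, hγ, -, hγβ⟩ := h 0 (pos_iff_ne_zero.2 h0)
    exact ⟨hγ.1.trans hγβ, hβ⟩

theorem isStationaryOmega1_Iio : IsStationaryOmega1 (Iio omega1) := by
  refine ⟨Subset.rfl, fun C hC => ?_⟩
  obtain ⟨β, hβ, -⟩ := hC.2.1 0 omega1_pos
  exact ⟨β, hC.1 hβ, hβ⟩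

theorem IsStationaryOmega1.not_countable {S : Set Ordinal} (hS : IsStationaryOmega1 S) :
    ¬ S.Countable := by
  intro hc
  have := hc.to_subtype
  obtain ⟨x, hxS, hx⟩ := hS.2 _ (isClubOmega1_Ioo (iSup_lt_omega1 fun x : S => hS.1 x.2))
  have : Small.{0} S := Countable.toSmall S
  exact hx.1.not_ge (Ordinal.le_iSup (fun x : S => (x : Ordinal)) ⟨x, hxS⟩)

/-- If a stationary set is covered by countably many sets, one of them has stationary trace. -/
theorem IsStationaryOmega1.exists_inter {ι : Type} [Countable ι] [Nonempty ι] {S : Set Ordinal}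
    (hS : IsStationaryOmega1 S) {A : ι → Set Ordinal} (hA : S ⊆ ⋃ i, A i) :
    ∃ i, IsStationaryOmega1 (S ∩ A i) := by
  by_contra! h
  have h' (i : ι) : ∃ C, IsClubOmega1 C ∧ ¬ (S ∩ A i ∩ C).Nonempty := by
    by_contra! hi
    exact h i ⟨inter_subset_left.trans hS.1, hi⟩
  choose C hC hdisj using h'
  obtain ⟨x, hxS, hxC⟩ := hS.2 _ (IsClubOmega1.iInter hC)
  obtain ⟨i, hi⟩ := mem_iUnion.1 (hA hxS)
  exact hdisj i ⟨x, ⟨hxS, hi⟩, mem_iInter.1 hxC i⟩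

theorem Centered.mono {P : Type*} [PartialOrder P] {A B : Set P} (hB : Centered B) (h : A ⊆ B) :
    Centered A :=
  fun F hF => hB F (hF.trans h)

theorem stationarilyKnaster_of_sigma_linked {P : Type*} [PartialOrder P] {f : ℕ → Set P}
    (hf : ∀ n, Linked (f n)) (hcover : ⋃ n, f n = univ) : StationarilyKnaster P := by
  intro S hS p
  obtain ⟨n, hn⟩ := hS.exists_inter (A := fun n => p ⁻¹' f n)
    (by rw [← preimage_iUnion, hcover]; exact subset_univ S)
  exact ⟨_, inter_subset_left, hn, fun i hi j hj => hf n _ hi.2 _ hj.2⟩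

theorem exists_injOn_Iio_omega1 {P : Type*} (hP : Cardinal.aleph 1 ≤ Cardinal.mk P) :
    ∃ p : Ordinal.{0} → P, InjOn p (Iio omega1) := by
  have : Nonempty P := Cardinal.mk_ne_zero_iff.1
    ((Cardinal.aleph_pos 1).trans_le hP).ne'
  obtain ⟨e⟩ : Nonempty (Iio omega1 ↪ P) := by
    rw [← Cardinal.lift_mk_le', Cardinal.mk_Iio_ordinal, omega1, Cardinal.card_ord]
    simpa using hP
  refine ⟨Function.extend Subtype.val e fun _ => Classical.arbitrary P, fun x hx y hy h => ?_⟩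
  have val_inj := Subtype.val_injective (p := (· ∈ Iio omega1))
  have hxy : e ⟨x, hx⟩ = e ⟨y, hy⟩ := by
    rw [← val_inj.extend_apply e (fun _ => Classical.arbitrary P) ⟨x, hx⟩,
      ← val_inj.extend_apply e (fun _ => Classical.arbitrary P) ⟨y, hy⟩]
    exact h
  exact congrArg Subtype.val (e.injective hxy)

/-- Stationary precaliber `ω₁` yields a centered set of size `ℵ₁` in any large enough order. -/
theorem StationaryPrecaliber.exists_centered {P : Type*} [PartialOrder P]
    (h : StationaryPrecaliber P) (hP : Cardinal.aleph 1 ≤ Cardinal.mk P) :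
    ∃ B : Set P, Centered B ∧ Cardinal.mk ↥B = Cardinal.aleph 1 := by
  obtain ⟨p, hp⟩ := exists_injOn_Iio_omega1 hP
  obtain ⟨T, -, hT, hcent⟩ := h _ isStationaryOmega1_Iio p
  have hcard : Cardinal.aleph 1 ≤ Cardinal.mk (p '' T) := by
    rw [Cardinal.aleph_one_le_iff, ← not_le, Cardinal.le_aleph0_iff_set_countable]
    exact fun hc => hT.not_countable (countable_of_injective_of_countable_image (hp.mono hT.1) hc)
  obtain ⟨B, hB, hBcard⟩ := Cardinal.le_mk_iff_exists_subset.1 hcard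
  exact ⟨B, hcent.mono hB, hBcard⟩

/-- A σ-linked partial order with at least ℵ₁-many conditions and no centered
subset of size ℵ₁ is stationarily Knaster but does not have stationary
precaliber ω₁. -/
theorem sigma_linked_no_large_centered (P : Type*) [PartialOrder P]
    (hσ : ∃ f : ℕ → Set P, (∀ n, Linked (f n)) ∧ (⋃ n, f n) = Set.univ)
    (hbig : Cardinal.aleph 1 ≤ Cardinal.mk P)
    (hnocent : ¬ ∃ B : Set P, Centered B ∧ Cardinal.mk ↥B = Cardinal.aleph 1) :
    StationarilyKnaster P ∧ ¬ StationaryPrecaliber P := by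
  obtain ⟨f, hf, hcover⟩ := hσ
  exact ⟨stationarilyKnaster_of_sigma_linked hf hcover, fun h => hnocent (h.exists_centered hbig)⟩
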